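/- Let X be a nonempty finite set, y : X → ℝ a probability vector (y(x) ≥ 0 for all x and ∑_{x∈X} y(x) = 1), ℓ : X → ℝ with ℓ(x) ≥ 0 for all x, and η > 0 with η·∑_{x∈X} y(x)·ℓ(x) < 1. Let x' ∈ X with y(x') > 0, and define p(x') := y(x')·exp(−η·ℓ(x')) / ∑_{x∈X} y(x)·exp(−η·ℓ(x)). Then ∑_{x∈X} y(x)·ℓ(x) − ℓ(x') ≤ (1/η)·log(p(x')/y(x')) + (η/2)·∑_{x∈X} y(x)·ℓ(x)². -/

import Mathlib

theorem Real.exp_neg_le_quadratic {t : ℝ} (ht : 0 ≤ t) :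
    Real.exp (-t) ≤ 1 - t + t ^ 2 / 2 := by
  have h := Real.quadratic_le_exp_of_nonneg ht
  have hpos : 0 ≤ 1 - t + t ^ 2 / 2 := by nlinarith [sq_nonneg (t - 1)]
  rw [Real.exp_neg, inv_le_iff_one_le_mul₀ (Real.exp_pos t)]
  calc (1 : ℝ) ≤ (1 - t + t ^ 2 / 2) * (1 + t + t ^ 2 / 2) := by nlinarith [sq_nonneg (t ^ 2)]
    _ ≤ (1 - t + t ^ 2 / 2) * Real.exp t := mul_le_mul_of_nonneg_left h hpos

theorem sum_mul_exp_neg_le_quadratic {X : Type*} [Fintype X] {y ℓ : X → ℝ}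
    (hy0 : ∀ x, 0 ≤ y x) (hy1 : ∑ x, y x = 1) (hℓ : ∀ x, 0 ≤ ℓ x) {η : ℝ} (hη : 0 ≤ η) :
    ∑ x, y x * Real.exp (-η * ℓ x)
      ≤ 1 - η * ∑ x, y x * ℓ x + η ^ 2 / 2 * ∑ x, y x * ℓ x ^ 2 := by
  rw [← hy1, Finset.mul_sum, Finset.mul_sum, ← Finset.sum_sub_distrib, ← Finset.sum_add_distrib]
  refine Finset.sum_le_sum fun x _ => ?_
  rw [neg_mul]
  calc y x * Real.exp (-(η * ℓ x))
      ≤ y x * (1 - η * ℓ x + (η * ℓ x) ^ 2 / 2) :=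
        mul_le_mul_of_nonneg_left (Real.exp_neg_le_quadratic (mul_nonneg hη (hℓ x))) (hy0 x)
    _ = y x - η * (y x * ℓ x) + η ^ 2 / 2 * (y x * ℓ x ^ 2) := by ring

theorem stmt_10 {X : Type*} [Fintype X] [Nonempty X]
    (y ℓ : X → ℝ)
    (hy0 : ∀ x, 0 ≤ y x) (hy1 : ∑ x, y x = 1)
    (hℓ : ∀ x, 0 ≤ ℓ x)
    (η : ℝ) (hη : 0 < η)
    (hηℓ : η * ∑ x, y x * ℓ x < 1)
    (x' : X) (hx' : 0 < y x') :
    (∑ x, y x * ℓ x) - ℓ x'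
      ≤ (1 / η) * Real.log
          ((y x' * Real.exp (-η * ℓ x') / ∑ x, y x * Real.exp (-η * ℓ x)) / y x')
        + (η / 2) * ∑ x, y x * (ℓ x) ^ 2 := by
  have hZ := sum_mul_exp_neg_le_quadratic hy0 hy1 hℓ hη.le
  have hZpos : 0 < ∑ x, y x * Real.exp (-η * ℓ x) :=
    Finset.sum_pos' (fun x _ => mul_nonneg (hy0 x) (Real.exp_pos _).le)
      ⟨x', Finset.mem_univ _, mul_pos hx' (Real.exp_pos _)⟩
  set Z := ∑ x, y x * Real.exp (-η * ℓ x)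
  set S := ∑ x, y x * ℓ x
  set Q := ∑ x, y x * ℓ x ^ 2
  have hratio : y x' * Real.exp (-η * ℓ x') / Z / y x' = Real.exp (-η * ℓ x') / Z := by
    field_simp
  rw [hratio, Real.log_div (Real.exp_pos _).ne' hZpos.ne', Real.log_exp]
  have hlog : Real.log Z ≤ -η * S + η ^ 2 / 2 * Q := by
    linarith [Real.log_le_sub_one_of_pos hZpos]
  calc S - ℓ x' = 1 / η * (-η * ℓ x' - (-η * S + η ^ 2 / 2 * Q)) + η / 2 * Q := by
        field_simp
        ring
    _ ≤ 1 / η * (-η * ℓ x' - Real.log Z) + η / 2 * Q := by gcongr
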